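/- For every n ≥ 4, the complete graph on n vertices is not cyclically orientable. -/

import Mathlib

/-- For every `n ≥ 4`, the complete graph on `n` vertices is not cyclically orientable: there is
no orientation `D` of its edges such that every chordless cycle — i.e. every triangle — is
cyclically oriented. -/
theorem stmt_1 (n : ℕ) (hn : 4 ≤ n) :
    ¬ ∃ D : Fin n → Fin n → Prop,
      (∀ u v : Fin n, u ≠ v → (D u v ↔ ¬ D v u)) ∧
      (∀ a b c : Fin n, a ≠ b → b ≠ c → a ≠ c →
        ((D a b ∧ D b c ∧ D c a) ∨ (D b a ∧ D c b ∧ D a c))) := by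
  rintro ⟨D, hD, hT⟩
  obtain ⟨f, hf⟩ : ∃ f : Fin 4 → Fin n, Function.Injective f :=
    ⟨Fin.castLE hn, Fin.castLE_injective hn⟩
  have ne : ∀ i j : Fin 4, i ≠ j → f i ≠ f j := fun i j h => hf.ne h
  have h01 := hD (f 0) (f 1) (ne _ _ (by decide))
  have h02 := hD (f 0) (f 2) (ne _ _ (by decide))
  have h03 := hD (f 0) (f 3) (ne _ _ (by decide))
  have t012 := hT (f 0) (f 1) (f 2) (ne _ _ (by decide)) (ne _ _ (by decide)) (ne _ _ (by decide))
  have t013 := hT (f 0) (f 1) (f 3) (ne _ _ (by decide)) (ne _ _ (by decide)) (ne _ _ (by decide))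
  have t023 := hT (f 0) (f 2) (f 3) (ne _ _ (by decide)) (ne _ _ (by decide)) (ne _ _ (by decide))
  clear hD hT ne
  grind
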